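/- Let A be the presented group with generators a, b, c and relations ab = ba, bcb = cbc, and acaca = cacac. Then there is no group homomorphism ρ : A → A with ρ(a) = a, ρ(b) = b, and ρ(c) lying in the subgroup generated by a and b; that is, A admits no retraction onto the standard parabolic subgroup generated by a and b. -/

import Mathlib

/-- Relations of the Artin group of the triangle `(2,3,5)` on generators
`a = 0`, `b = 1`, `c = 2`: `ab = ba`, `bcb = cbc`, `acaca = cacac`. -/
def triangleRels : Set (FreeGroup (Fin 3)) :=
  { FreeGroup.of 0 * FreeGroup.of 1 * (FreeGroup.of 1 * FreeGroup.of 0)⁻¹,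
    FreeGroup.of 1 * FreeGroup.of 2 * FreeGroup.of 1 *
      (FreeGroup.of 2 * FreeGroup.of 1 * FreeGroup.of 2)⁻¹,
    FreeGroup.of 0 * FreeGroup.of 2 * FreeGroup.of 0 * FreeGroup.of 2 * FreeGroup.of 0 *
      (FreeGroup.of 2 * FreeGroup.of 0 * FreeGroup.of 2 * FreeGroup.of 0 * FreeGroup.of 2)⁻¹ }

/-- Permutations of five points satisfying the relations of the Artin group `(2,3,5)`. -/
def triangleRepr : Fin 3 → Equiv.Perm (Fin 5) :=
  ![Equiv.swap 0 1 * Equiv.swap 2 3, Equiv.swap 0 2 * Equiv.swap 1 3,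
    Equiv.swap 0 4 * Equiv.swap 1 3]

theorem lift_triangleRepr_eq_one :
    ∀ r ∈ triangleRels, FreeGroup.lift triangleRepr r = 1 := by
  rintro r (rfl | rfl | rfl) <;>
    simp only [map_mul, map_inv, FreeGroup.lift_apply_of, mul_inv_eq_one] <;> decide

theorem of_zero_ne_of_one :
    (PresentedGroup.of 0 : PresentedGroup triangleRels) ≠ PresentedGroup.of 1 := by
  intro h
  have h' := congrArg (PresentedGroup.toGroup lift_triangleRepr_eq_one) h
  simp only [PresentedGroup.toGroup.of] at h'
  exact absurd h' (by decide)

theorem of_braid_one_two :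
    (PresentedGroup.of 1 * PresentedGroup.of 2 * PresentedGroup.of 1 :
      PresentedGroup triangleRels) =
      PresentedGroup.of 2 * PresentedGroup.of 1 * PresentedGroup.of 2 :=
  mul_inv_eq_one.mp (PresentedGroup.one_of_mem (rels := triangleRels) (Or.inr (Or.inl rfl)))

theorem of_braid_zero_two :
    (PresentedGroup.of 0 * PresentedGroup.of 2 * PresentedGroup.of 0 * PresentedGroup.of 2 *
      PresentedGroup.of 0 : PresentedGroup triangleRels) =
      PresentedGroup.of 2 * PresentedGroup.of 0 * PresentedGroup.of 2 * PresentedGroup.of 0 *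
        PresentedGroup.of 2 :=
  mul_inv_eq_one.mp (PresentedGroup.one_of_mem (rels := triangleRels) (Or.inr (Or.inr rfl)))

theorem of_commute_zero_one :
    Commute (PresentedGroup.of 0 : PresentedGroup triangleRels) (PresentedGroup.of 1) :=
  mul_inv_eq_one.mp (PresentedGroup.one_of_mem (rels := triangleRels) (Or.inl rfl))

theorem Commute.eq_of_braid_three {G : Type*} [Group G] {x y : G} (h : Commute x y)
    (hb : x * y * x = y * x * y) : x = y := by
  rw [h.eq] at hb
  exact mul_left_cancel hb

theorem Commute.eq_of_braid_five {G : Type*} [Group G] {x y : G} (h : Commute x y)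
    (hb : x * y * x * y * x = y * x * y * x * y) : x = y := by
  have e : x * y * x * y = y * x * y * x := by rw [h.eq, mul_assoc, h.eq, ← mul_assoc]
  rw [e] at hb
  exact mul_left_cancel hb

/-- The Artin group of the triangle `(2,3,5)` admits no retraction onto the standard
parabolic subgroup generated by `a` and `b`. -/
theorem no_retraction_235 :
    ¬ ∃ ρ : PresentedGroup triangleRels →* PresentedGroup triangleRels,
        ρ (PresentedGroup.of 0) = PresentedGroup.of 0 ∧
        ρ (PresentedGroup.of 1) = PresentedGroup.of 1 ∧
        ρ (PresentedGroup.of 2) ∈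
          Subgroup.closure {PresentedGroup.of 0, PresentedGroup.of 1} := by
  rintro ⟨ρ, h0, h1, h2⟩
  have c0 : Commute (PresentedGroup.of 0) (ρ (PresentedGroup.of 2)) := by
    refine Subgroup.mem_centralizer_singleton_iff.mp
      ((Subgroup.closure_le _).mpr ?_ h2) |>.symm
    rintro x (rfl | rfl)
    · exact Subgroup.mem_centralizer_singleton_iff.mpr rfl
    · exact Subgroup.mem_centralizer_singleton_iff.mpr of_commute_zero_one.symm.eq
  have c1 : Commute (PresentedGroup.of 1) (ρ (PresentedGroup.of 2)) := by
    refine Subgroup.mem_centralizer_singleton_iff.mp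
      ((Subgroup.closure_le _).mpr ?_ h2) |>.symm
    rintro x (rfl | rfl)
    · exact Subgroup.mem_centralizer_singleton_iff.mpr of_commute_zero_one.eq
    · exact Subgroup.mem_centralizer_singleton_iff.mpr rfl
  have b1 := congrArg ρ of_braid_one_two
  have b0 := congrArg ρ of_braid_zero_two
  simp only [map_mul, h0, h1] at b0 b1
  exact of_zero_ne_of_one ((c0.eq_of_braid_five b0).trans (c1.eq_of_braid_three b1).symm)
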